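/- arXiv:1210.7659 — 3 statements merged into one kernel-verified Lean document; each statement's English description precedes it below -/
import Mathlib

section
/- Let X and Y be finite sets and S a nonempty subset of X × Y with N = |S|. Let S_X = {x ∈ X : ∃ y, (x,y) ∈ S} and S_Y = {y ∈ Y : ∃ x, (x,y) ∈ S} be the projections of S, and define the equiprobable joint distribution Pr(x,y) = 1/N if (x,y) ∈ S and Pr(x,y) = 0 otherwise, with marginals Pr(x) = Σ_y Pr(x,y) and Pr(y) = Σ_x Pr(x,y). Then S = S_X × S_Y (i.e., S is 'separated') if and only if the distribution is independent, i.e., Pr(x,y) = Pr(x)·Pr(y) for all (x,y) ∈ X × Y. -/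
open Finset

/-- For a nonempty subset S of a product of finite sets X × Y,
S is "separated" (equal to the product of its projections) iff the
equiprobable distribution supported on S is independent. -/
theorem stmt_1 {X Y : Type} [Fintype X] [Fintype Y] [DecidableEq X] [DecidableEq Y]
    (S : Finset (X × Y)) (hS : S.Nonempty)
    (Pr : X → Y → ℝ)
    (hPr : ∀ x y, Pr x y = if (x, y) ∈ S then 1 / (S.card : ℝ) else 0) :
    S = (S.image Prod.fst) ×ˢ (S.image Prod.snd) ↔
      ∀ x y, Pr x y = (∑ y', Pr x y') * (∑ x', Pr x' y) := by
  have hN : (0 : ℝ) < S.card := by exact_mod_cast hS.card_pos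
  constructor
  · intro h
    generalize S.image Prod.fst = A at h
    generalize S.image Prod.snd = B at h
    subst h
    have row : ∀ x, ∑ y', Pr x y' = if x ∈ A then (B.card : ℝ) * (1 / (A ×ˢ B).card) else 0 := by
      intro x
      by_cases hx : x ∈ A <;> simp [hPr, hx, Finset.sum_ite_mem]
    have col : ∀ y, ∑ x', Pr x' y = if y ∈ B then (A.card : ℝ) * (1 / (A ×ˢ B).card) else 0 := by
      intro y
      by_cases hy : y ∈ B <;> simp [hPr, hy, Finset.sum_ite_mem]
    intro x y
    rw [row, col, hPr]
    by_cases hx : x ∈ A <;> by_cases hy : y ∈ B <;> simp only [mem_product, hx, hy, and_self,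
      and_true, and_false, if_true, if_false, mul_zero, zero_mul]
    rw [card_product, Nat.cast_mul] at *
    have hA : (A.card : ℝ) ≠ 0 := left_ne_zero_of_mul hN.ne'
    have hB : (B.card : ℝ) ≠ 0 := right_ne_zero_of_mul hN.ne'
    field_simp
  · intro h
    have nonneg : ∀ x y, 0 ≤ Pr x y := by
      intro x y
      rw [hPr]
      split_ifs
      exacts [(one_div_pos.2 hN).le, le_rfl]
    have pos : ∀ {x y}, (x, y) ∈ S → 0 < Pr x y := by
      intro x y hxy
      rw [hPr, if_pos hxy]
      exact one_div_pos.2 hN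
    refine subset_antisymm subset_product ?_
    rintro ⟨x, y⟩ hxy
    simp only [mem_product, mem_image, Prod.exists, exists_and_right, exists_eq_right] at hxy
    obtain ⟨⟨y₀, hy₀⟩, ⟨x₀, hx₀⟩⟩ := hxy
    have hrow : 0 < ∑ y', Pr x y' :=
      sum_pos' (fun _ _ => nonneg _ _) ⟨y₀, mem_univ _, pos hy₀⟩
    have hcol : 0 < ∑ x', Pr x' y :=
      sum_pos' (fun _ _ => nonneg _ _) ⟨x₀, mem_univ _, pos hx₀⟩
    by_contra hmem
    have hzero := h x y
    rw [hPr, if_neg hmem] at hzero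
    exact (mul_pos hrow hcol).ne hzero
end

section
/- Let π be a partition of the finite index set {1, …, n} and let p₁, …, pₙ be nonnegative reals with Σᵢ pᵢ = 1. Define the n×n real matrix ρ^π by ρ^π_{ij} = √(pᵢ pⱼ) if i and j lie in the same block of π, and ρ^π_{ij} = 0 otherwise. Then ρ^π is a density matrix (Hermitian, positive semidefinite, trace 1), tr[(ρ^π)²] equals the probability Σ_{(i,j)∈indit(π)} pᵢ pⱼ of drawing an indistinction of π in two independent draws, and hence h(ρ^π) = 1 − tr[(ρ^π)²] = 1 − Σ_{B∈π} p_B², where p_B = Σ_{i∈B} pᵢ. -/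
open Finset Matrix

/-- The pairs lying in a common block of a disjoint family are summed block by block. -/
theorem sum_filter_exists_mem_eq_sum_product {α M : Type*} [Fintype α] [DecidableEq α]
    [AddCommMonoid M] (π : Finset (Finset α))
    (hdisj : ∀ B ∈ π, ∀ C ∈ π, B ≠ C → Disjoint B C) (f : α × α → M) :
    ∑ ij ∈ (Finset.univ : Finset (α × α)).filter (fun ij => ∃ B ∈ π, ij.1 ∈ B ∧ ij.2 ∈ B), f ij =
      ∑ B ∈ π, ∑ ij ∈ B ×ˢ B, f ij := by
  rw [← Finset.sum_biUnion]
  · congr 1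
    ext ij
    simp
  · intro B hB C hC hBC
    exact Finset.disjoint_product.2 (Or.inl (hdisj B hB C hC hBC))

/-- A real matrix with entries `v i * v j` on pairs in a common block of a disjoint family, and `0`
elsewhere, is the sum over the blocks of the rank-one matrices of the restrictions of `v`. -/
theorem eq_sum_vecMulVec_of_disjoint {α : Type*} [DecidableEq α] (π : Finset (Finset α))
    (hdisj : ∀ B ∈ π, ∀ C ∈ π, B ≠ C → Disjoint B C) (v : α → ℝ) (ρ : Matrix α α ℝ)
    (h_indit : ∀ i j, (∃ B ∈ π, i ∈ B ∧ j ∈ B) → ρ i j = v i * v j)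
    (h_dit : ∀ i j, ¬ (∃ B ∈ π, i ∈ B ∧ j ∈ B) → ρ i j = 0) :
    ρ = ∑ B ∈ π, vecMulVec (fun i => if i ∈ B then v i else 0)
      (star fun i => if i ∈ B then v i else 0) := by
  ext i j
  simp only [Matrix.sum_apply, vecMulVec_apply, star_trivial]
  by_cases h : ∃ B ∈ π, i ∈ B ∧ j ∈ B
  · rw [h_indit i j h]
    obtain ⟨B, hB, hi, hj⟩ := h
    rw [Finset.sum_eq_single_of_mem B hB]
    · simp [hi, hj]
    · intro C hC hCB
      simp [Finset.disjoint_left.1 (hdisj B hB C hC hCB.symm) hi]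
  · rw [h_dit i j h, Finset.sum_eq_zero]
    intro B hB
    by_cases hi : i ∈ B
    · have hj : j ∉ B := fun hj => h ⟨B, hB, hi, hj⟩
      simp [hj]
    · simp [hi]

/-- the density matrix ρ^π of a partition π of {1,…,n} with
point probabilities p (entries √(pᵢpⱼ) on indits, 0 on dits) is a genuine
density matrix, tr[(ρ^π)²] is the probability of drawing an indistinction,
and h(ρ^π) = 1 − tr[(ρ^π)²] = 1 − Σ_{B∈π} p_B² with p_B = Σ_{i∈B} pᵢ. -/
theorem stmt_10 {n : ℕ} (π : Finset (Finset (Fin n)))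
    (hne : ∀ B ∈ π, B.Nonempty)
    (hdisj : ∀ B ∈ π, ∀ C ∈ π, B ≠ C → Disjoint B C)
    (hcover : ∀ u : Fin n, ∃ B ∈ π, u ∈ B)
    (p : Fin n → ℝ) (hnn : ∀ i, 0 ≤ p i) (hsum : ∑ i, p i = 1)
    (ρ : Matrix (Fin n) (Fin n) ℝ)
    (hρ : ∀ i j, ((∃ B ∈ π, i ∈ B ∧ j ∈ B) → ρ i j = Real.sqrt (p i * p j)) ∧
                 (¬ (∃ B ∈ π, i ∈ B ∧ j ∈ B) → ρ i j = 0)) :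
    ρ.IsHermitian ∧ ρ.PosSemidef ∧ ρ.trace = 1 ∧
    (ρ * ρ).trace =
      ∑ ij ∈ (Finset.univ : Finset (Fin n × Fin n)).filter
          (fun ij => ∃ B ∈ π, ij.1 ∈ B ∧ ij.2 ∈ B), p ij.1 * p ij.2 ∧
    1 - (ρ * ρ).trace = 1 - ∑ B ∈ π, (∑ i ∈ B, p i) ^ 2 := by
  have hpsd : ρ.PosSemidef := by
    rw [eq_sum_vecMulVec_of_disjoint π hdisj (fun i => √(p i)) ρ
      (fun i j h => by rw [(hρ i j).1 h, Real.sqrt_mul (hnn i)]) (fun i j h => (hρ i j).2 h)]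
    exact posSemidef_sum π fun B _ => posSemidef_vecMulVec_self_star _
  have htrace : ρ.trace = 1 := by
    rw [← hsum]
    refine Finset.sum_congr rfl fun i _ => ?_
    obtain ⟨B, hB, hi⟩ := hcover i
    rw [diag_apply, (hρ i i).1 ⟨B, hB, hi, hi⟩, Real.sqrt_mul_self (hnn i)]
  have hsq : (ρ * ρ).trace =
      ∑ ij ∈ (Finset.univ : Finset (Fin n × Fin n)).filter
          (fun ij => ∃ B ∈ π, ij.1 ∈ B ∧ ij.2 ∈ B), p ij.1 * p ij.2 := by
    rw [Finset.sum_filter, Fintype.sum_prod_type]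
    refine Finset.sum_congr rfl fun i _ => ?_
    rw [diag_apply, mul_apply]
    refine Finset.sum_congr rfl fun j _ => ?_
    have hsymm : ρ j i = ρ i j := hpsd.isHermitian.apply i j
    rw [hsymm]
    split_ifs with h
    · rw [(hρ i j).1 h, Real.mul_self_sqrt (mul_nonneg (hnn i) (hnn j))]
    · rw [(hρ i j).2 h, mul_zero]
  refine ⟨hpsd.isHermitian, hpsd, htrace, hsq, ?_⟩
  rw [hsq, sum_filter_exists_mem_eq_sum_product π hdisj]
  congr 1
  refine Finset.sum_congr rfl fun B _ => ?_
  rw [sq, Finset.sum_mul_sum, Finset.sum_product]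
end

section
/- Let π and σ be partitions of a set U, and let σ ⇒ π be the implication partition (each block B of π contained in some block of σ is replaced by the singletons of its elements; other blocks of π are unchanged). Then dit(σ ⇒ π) = int( dit(σ)ᶜ ∪ dit(π) ), where int(S) = (cl(Sᶜ))ᶜ is the largest partition relation contained in S and cl denotes the smallest equivalence relation containing a given relation. -/
/-- A partition of a set `U`: nonempty pairwise disjoint blocks whose union is `U`. -/
def IsPartition {U : Type} (π : Set (Set U)) : Prop :=
  (∀ B ∈ π, B.Nonempty) ∧ (∀ B ∈ π, ∀ C ∈ π, B ≠ C → Disjoint B C) ∧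
    ⋃₀ π = Set.univ

/-- The dit set of a partition: ordered pairs whose components lie in distinct
blocks. -/
def dit {U : Type} (π : Set (Set U)) : Set (U × U) :=
  {p | ∃ B ∈ π, ∃ C ∈ π, B ≠ C ∧ p.1 ∈ B ∧ p.2 ∈ C}

/-- An equivalence relation on `U`, viewed as a subset of `U × U`. -/
def IsEqvRel {U : Type} (R : Set (U × U)) : Prop :=
  (∀ u : U, (u, u) ∈ R) ∧ (∀ u v : U, (u, v) ∈ R → (v, u) ∈ R) ∧
    (∀ u v w : U, (u, v) ∈ R → (v, w) ∈ R → (u, w) ∈ R)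

/-- The smallest equivalence relation containing `T`. -/
def cl {U : Type} (T : Set (U × U)) : Set (U × U) :=
  ⋂₀ {R | T ⊆ R ∧ IsEqvRel R}

/-- The interior of `S`: complement of the closure of the complement; the
largest partition relation contained in `S`. -/
def intr {U : Type} (S : Set (U × U)) : Set (U × U) :=
  (cl Sᶜ)ᶜ

/-- The implication partition σ ⇒ π: each block B of π contained in some block
of σ is replaced by the singletons of its elements; the other blocks of π are
left unchanged. -/
def implP {U : Type} (σ π : Set (Set U)) : Set (Set U) :=
  {S | (∃ B ∈ π, (∃ C ∈ σ, B ⊆ C) ∧ ∃ u ∈ B, S = {u}) ∨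
       (∃ B ∈ π, (¬ ∃ C ∈ σ, B ⊆ C) ∧ S = B)}

namespace IsPartition

variable {U : Type} {π σ : Set (Set U)}

theorem exists_mem_block (hπ : IsPartition π) (u : U) : ∃ B ∈ π, u ∈ B :=
  Set.mem_sUnion.1 (hπ.2.2 ▸ Set.mem_univ u)

theorem block_unique (hπ : IsPartition π) {B C : Set U} (hB : B ∈ π) (hC : C ∈ π) {u : U}
    (huB : u ∈ B) (huC : u ∈ C) : B = C :=
  by_contra fun h => Set.disjoint_left.1 (hπ.2.1 B hB C hC h) huB huC

theorem notMem_dit_iff (hπ : IsPartition π) {u v : U} :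
    (u, v) ∉ dit π ↔ ∃ B ∈ π, u ∈ B ∧ v ∈ B := by
  constructor
  · intro h
    obtain ⟨B, hB, huB⟩ := hπ.exists_mem_block u
    obtain ⟨C, hC, hvC⟩ := hπ.exists_mem_block v
    by_cases hBC : B = C
    · exact ⟨B, hB, huB, hBC ▸ hvC⟩
    · exact absurd ⟨B, hB, C, hC, hBC, huB, hvC⟩ h
  · rintro ⟨B, hB, huB, hvB⟩ ⟨C, hC, D, hD, hCD, huC, hvD⟩
    exact hCD ((hπ.block_unique hC hB huC huB).trans (hπ.block_unique hB hD hvB hvD))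

theorem isEqvRel_compl_dit (hπ : IsPartition π) : IsEqvRel (dit π)ᶜ := by
  simp only [IsEqvRel, Set.mem_compl_iff, hπ.notMem_dit_iff]
  refine ⟨fun u => ?_, ?_, ?_⟩
  · obtain ⟨B, hB, hu⟩ := hπ.exists_mem_block u
    exact ⟨B, hB, hu, hu⟩
  · rintro u v ⟨B, hB, hu, hv⟩
    exact ⟨B, hB, hv, hu⟩
  · rintro u v w ⟨B, hB, hu, hv⟩ ⟨C, hC, hv', hw⟩
    exact ⟨B, hB, hu, hπ.block_unique hC hB hv' hv ▸ hw⟩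

/-- The implication partition is a partition, for an arbitrary collection `σ`. -/
theorem implP (hπ : IsPartition π) (σ : Set (Set U)) : IsPartition (implP σ π) := by
  refine ⟨?_, ?_, Set.eq_univ_of_forall fun u => ?_⟩
  · rintro S (⟨B, -, -, u, -, rfl⟩ | ⟨B, hB, -, rfl⟩)
    · exact Set.singleton_nonempty u
    · exact hπ.1 _ hB
  · intro S hS T hT hST
    refine Set.disjoint_left.2 fun x hxS hxT => hST ?_
    rcases hS with ⟨B, hB, hBσ, u, hu, rfl⟩ | ⟨B, hB, hBσ, rfl⟩ <;>
      rcases hT with ⟨C, hC, hCσ, v, hv, rfl⟩ | ⟨C, hC, hCσ, rfl⟩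
    · rw [← Set.mem_singleton_iff.1 hxS, ← Set.mem_singleton_iff.1 hxT]
    · obtain rfl := Set.mem_singleton_iff.1 hxS
      exact absurd (hπ.block_unique hB hC hu hxT ▸ hBσ) hCσ
    · obtain rfl := Set.mem_singleton_iff.1 hxT
      exact absurd (hπ.block_unique hC hB hv hxS ▸ hCσ) hBσ
    · exact hπ.block_unique hB hC hxS hxT
  · obtain ⟨B, hB, hu⟩ := hπ.exists_mem_block u
    by_cases h : ∃ C ∈ σ, B ⊆ C
    · exact ⟨{u}, Or.inl ⟨B, hB, h, u, hu, rfl⟩, rfl⟩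
    · exact ⟨B, Or.inr ⟨B, hB, h, rfl⟩, hu⟩

/-- Two points in a block of `π` that no block of `σ` contains are related by every equivalence
relation containing the pairs distinguished by `σ` but not by `π`. -/
theorem mem_of_block_not_subset (hπ : IsPartition π) (hσ : IsPartition σ) {R : Set (U × U)}
    (hR : IsEqvRel R) (hsub : dit σ \ dit π ⊆ R) {B : Set U} (hB : B ∈ π)
    (hBσ : ¬ ∃ C ∈ σ, B ⊆ C) {u v : U} (hu : u ∈ B) (hv : v ∈ B) : (u, v) ∈ R := by
  have key {x y : U} (hx : x ∈ B) (hy : y ∈ B) (h : (x, y) ∈ dit σ) : (x, y) ∈ R :=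
    hsub ⟨h, hπ.notMem_dit_iff.2 ⟨B, hB, hx, hy⟩⟩
  by_cases huv : (u, v) ∈ dit σ
  · exact key hu hv huv
  obtain ⟨C, hC, huC, hvC⟩ := hσ.notMem_dit_iff.1 huv
  obtain ⟨w, hw, hwC⟩ := Set.not_subset.1 fun h => hBσ ⟨C, hC, h⟩
  obtain ⟨D, hD, hwD⟩ := hσ.exists_mem_block w
  have hCD : C ≠ D := fun h => hwC (h ▸ hwD)
  exact hR.2.2 u w v (key hu hw ⟨C, hC, D, hD, hCD, huC, hwD⟩)
    (key hw hv ⟨D, hD, C, hC, hCD.symm, hwD, hvC⟩)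

theorem diff_dit_subset_compl_dit_implP (hπ : IsPartition π) (hσ : IsPartition σ) :
    dit σ \ dit π ⊆ (dit (_root_.implP σ π))ᶜ := by
  rintro ⟨u, v⟩ ⟨huv, hnot⟩
  obtain ⟨B, hB, hu, hv⟩ := hπ.notMem_dit_iff.1 hnot
  refine (hπ.implP σ).notMem_dit_iff.2 ⟨B, Or.inr ⟨B, hB, ?_, rfl⟩, hu, hv⟩
  rintro ⟨C, hC, hBC⟩
  exact hσ.notMem_dit_iff.2 ⟨C, hC, hBC hu, hBC hv⟩ huv

end IsPartition

/-- dit(σ ⇒ π) = int(dit(σ)ᶜ ∪ dit(π)). -/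
theorem stmt_16 {U : Type} (π σ : Set (Set U))
    (hπ : IsPartition π) (hσ : IsPartition σ) :
    dit (implP σ π) = intr ((dit σ)ᶜ ∪ dit π) := by
  have hcompl : ((dit σ)ᶜ ∪ dit π)ᶜ = dit σ \ dit π := by
    rw [Set.compl_union, compl_compl, Set.sdiff_eq]
  rw [intr, hcompl, eq_compl_comm]
  refine Set.Subset.antisymm
    (Set.sInter_subset_of_mem
      ⟨hπ.diff_dit_subset_compl_dit_implP hσ, (hπ.implP σ).isEqvRel_compl_dit⟩) ?_
  rintro ⟨u, v⟩ huv R ⟨hsub, hR⟩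
  obtain ⟨S, ⟨B, hB, hBσ, w, hw, rfl⟩ | ⟨B, hB, hBσ, rfl⟩, hu, hv⟩ :=
    (hπ.implP σ).notMem_dit_iff.1 huv
  · rw [Set.mem_singleton_iff.1 hu, Set.mem_singleton_iff.1 hv]
    exact hR.1 w
  · exact hπ.mem_of_block_not_subset hσ hR hsub hB hBσ hu hv
end
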